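/- arXiv:1911.12989 — 5 statements merged into one kernel-verified Lean document; each statement's English description precedes it below -/
import Mathlib

section
/- Let (a_n) and (b_n) be sequences of real numbers such that for all n, a_n ≥ 0 and b_n ≥ 0, the series ∑ a_n diverges (∑_{n=1}^∞ a_n = ∞), the series ∑ a_n b_n converges (∑_{n=1}^∞ a_n b_n < ∞), and there exists a constant K > 0 such that |b_{n+1} − b_n| ≤ K a_n for all n. Then b_n → 0 as n → ∞. -/
/-- If `∑ a n` diverges and `∑ a n * b n` converges, then `b` takes arbitrarily small values
arbitrarily far out. -/
theorem exists_ge_lt_of_summable_mul_of_not_summable {a b : ℕ → ℝ} (ha : ∀ n, 0 ≤ a n)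
    (hdiv : ¬ Summable a) (hconv : Summable (fun n => a n * b n)) {ε : ℝ} (hε : 0 < ε) (n : ℕ) :
    ∃ m ≥ n, b m < ε := by
  by_contra! h
  refine hdiv ((summable_nat_add_iff n).1 ?_)
  refine Summable.of_nonneg_of_le (fun m => ha _) (fun m => ?_)
    (((summable_nat_add_iff n).2 hconv).mul_left ε⁻¹)
  rw [← div_eq_inv_mul, le_div_iff₀ hε]
  exact mul_le_mul_of_nonneg_left (h _ (Nat.le_add_left n m)) (ha _)

/-- If the decrements of `b ≥ 0` are bounded by `K * a n`, then `b n ^ 2` is bounded by the tail of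
`2 * K * ∑ a n * b n`. -/
theorem sq_le_two_mul_tsum_tail {a b : ℕ → ℝ} (ha : ∀ n, 0 ≤ a n) (hb : ∀ n, 0 ≤ b n)
    (hdiv : ¬ Summable a) (hconv : Summable (fun n => a n * b n)) {K : ℝ} (hK : 0 ≤ K)
    (hdec : ∀ n, b n - b (n + 1) ≤ K * a n) (n : ℕ) :
    b n ^ 2 ≤ 2 * K * ∑' k, a (k + n) * b (k + n) := by
  set T : ℕ → ℝ := fun n => ∑' k, a (k + n) * b (k + n) with hT
  have hT_succ (n : ℕ) : T n = a n * b n + T (n + 1) := by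
    have h := ((summable_nat_add_iff n).2 hconv).tsum_eq_zero_add
    simpa [hT, add_assoc, add_comm 1 n] using h
  have hmono : Monotone fun n => b n ^ 2 - 2 * K * T n := by
    refine monotone_nat_of_le_succ fun n => ?_
    rw [hT_succ n]
    nlinarith [mul_le_mul_of_nonneg_left (hdec n) (hb n), sq_nonneg (b n - b (n + 1))]
  refine le_of_forall_pos_le_add fun ε hε => ?_
  obtain ⟨m, hnm, hm⟩ := exists_ge_lt_of_summable_mul_of_not_summable ha hdiv hconv
    (Real.sqrt_pos.2 hε) n
  have h_sq : b m ^ 2 < ε := (Real.lt_sqrt (hb m)).1 hm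
  have h_tail : 0 ≤ 2 * K * T m :=
    mul_nonneg (by positivity) (tsum_nonneg fun k => mul_nonneg (ha _) (hb _))
  have h := hmono hnm
  change b n ^ 2 ≤ 2 * K * T n + ε
  dsimp only at h
  linarith

/-- Positive converging sums (Mairal et al.): if `a n ≥ 0`, `b n ≥ 0`, `∑ a n = ∞`,
`∑ a n * b n < ∞`, and `|b (n+1) - b n| ≤ K * a n` for some `K > 0`, then `b n → 0`. -/
theorem positive_converging_sums (a b : ℕ → ℝ)
    (ha : ∀ n, 0 ≤ a n) (hb : ∀ n, 0 ≤ b n)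
    (hdiv : ¬ Summable a)
    (hconv : Summable (fun n => a n * b n))
    (hK : ∃ K > (0 : ℝ), ∀ n, |b (n + 1) - b n| ≤ K * a n) :
    Filter.Tendsto b Filter.atTop (nhds 0) := by
  obtain ⟨K, hK, hdiff⟩ := hK
  have h_tail : Filter.Tendsto (fun n => 2 * K * ∑' k, a (k + n) * b (k + n))
      Filter.atTop (nhds 0) := by
    simpa using (tendsto_sum_nat_add fun n => a n * b n).const_mul (2 * K)
  have h_sq : Filter.Tendsto (fun n => b n ^ 2) Filter.atTop (nhds 0) :=
    squeeze_zero (fun n => sq_nonneg _) (sq_le_two_mul_tsum_tail ha hb hdiv hconv hK.le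
      fun n => by linarith [(abs_le.1 (hdiff n)).1]) h_tail
  simpa [Real.sqrt_sq, hb] using h_sq.sqrt
end

section
/- Let (b_n) be a sequence of nonnegative real numbers such that the series ∑_{n=1}^∞ b_n/(n+1) converges, and suppose there exists a constant K > 0 such that |b_{n+1} − b_n| ≤ K/(n+1) for all n. Then b_n → 0 as n → ∞. -/
/-- If `b ≥ 0` has increments `O(a n)`, where `a ≥ 0` is square summable but not summable,
and `∑ a n * b n` converges, then `b n → 0`. The point is that `b ^ 2` has summable increments. -/
theorem tendsto_zero_of_summable_mul_of_abs_sub_le {a b : ℕ → ℝ} {K : ℝ}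
    (ha : ∀ n, 0 ≤ a n) (ha_sq : Summable (fun n => a n ^ 2)) (ha_div : ¬ Summable a)
    (hb : ∀ n, 0 ≤ b n) (hab : Summable (fun n => a n * b n))
    (hK : ∀ n, |b (n + 1) - b n| ≤ K * a n) :
    Filter.Tendsto b Filter.atTop (nhds 0) := by
  have hcauchy : CauchySeq (fun n => b n ^ 2) := by
    refine cauchySeq_of_dist_le_of_summable (fun n => 2 * K * (a n * b n) + K ^ 2 * a n ^ 2)
      (fun n => ?_) ((hab.mul_left _).add (ha_sq.mul_left _))
    have hsum : b n + b (n + 1) ≤ 2 * b n + K * a n := by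
      linarith [le_abs_self (b (n + 1) - b n), hK n]
    calc dist (b n ^ 2) (b (n + 1) ^ 2)
        = |b (n + 1) - b n| * (b n + b (n + 1)) := by
          rw [dist_comm, Real.dist_eq, ← abs_of_nonneg (add_nonneg (hb n) (hb (n + 1))),
            ← abs_mul]
          ring_nf
      _ ≤ K * a n * (2 * b n + K * a n) :=
          mul_le_mul (hK n) hsum (add_nonneg (hb n) (hb (n + 1))) ((abs_nonneg _).trans (hK n))
      _ = 2 * K * (a n * b n) + K ^ 2 * a n ^ 2 := by ring
  obtain ⟨L, hL⟩ := cauchySeq_tendsto_of_complete hcauchy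
  have hlim : Filter.Tendsto b Filter.atTop (nhds √L) := by
    simpa only [Real.sqrt_sq (hb _)] using hL.sqrt
  rcases (Real.sqrt_nonneg L).eq_or_lt with h0 | hpos
  · rwa [← h0] at hlim
  · refine absurd (Summable.of_norm_bounded_eventually_nat (hab.mul_left (√L / 2)⁻¹) ?_) ha_div
    filter_upwards [hlim.eventually_const_lt (half_lt_self hpos)] with n hn
    rw [Real.norm_of_nonneg (ha n), le_inv_mul_iff₀ (half_pos hpos), mul_comm]
    exact mul_le_mul_of_nonneg_left hn.le (ha n)

/-- If `b n ≥ 0`, `∑ b n / (n+1)` converges, and `|b (n+1) - b n| ≤ K / (n+1)` for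
some `K > 0`, then `b n → 0`. -/
theorem positive_converging_sums_harmonic (b : ℕ → ℝ)
    (hb : ∀ n, 0 ≤ b n)
    (hconv : Summable (fun n => b n / ((n : ℝ) + 1)))
    (hK : ∃ K > (0 : ℝ), ∀ n, |b (n + 1) - b n| ≤ K / ((n : ℝ) + 1)) :
    Filter.Tendsto b Filter.atTop (nhds 0) := by
  obtain ⟨K, -, hK⟩ := hK
  refine tendsto_zero_of_summable_mul_of_abs_sub_le (a := fun n => 1 / ((n : ℝ) + 1)) (K := K)
    (fun n => by positivity) ?_ ?_ hb ?_ ?_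
  · simpa using (summable_nat_add_iff 1).2 (Real.summable_one_div_nat_pow.2 one_lt_two)
  · simpa using mt (summable_nat_add_iff 1).1 Real.not_summable_one_div_natCast
  · simpa only [one_div_mul_eq_div] using hconv
  · simpa only [mul_one_div] using hK
end

section
/- Let (Ω, F, P) be a probability space with a filtration (F_t)_{t∈ℕ}, and let (u_t)_{t∈ℕ} be an adapted sequence of integrable, nonnegative real-valued random variables. If ∑_{t=1}^∞ E[ (E[u_{t+1} − u_t | F_t])⁺ ] < ∞, where x⁺ = max{x, 0} denotes the positive part, then u_t converges almost surely to a finite limit, and moreover ∑_{t=1}^∞ |E[u_{t+1} − u_t | F_t]| < ∞ almost surely. -/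
open MeasureTheory Filter

namespace MeasureTheory

variable {Ω : Type*} {m0 : MeasurableSpace Ω} {μ : Measure Ω}

/-- If the `L¹` norms of a sequence of integrable functions are summable, then the norms are
almost everywhere summable. -/
lemma ae_summable_norm_of_summable_integral_norm {ι E : Type*} [Countable ι]
    [NormedAddCommGroup E] {f : ι → Ω → E} (hf : ∀ i, Integrable (f i) μ)
    (hsum : Summable fun i => ∫ ω, ‖f i ω‖ ∂μ) :
    ∀ᵐ ω ∂μ, Summable fun i => ‖f i ω‖ := by
  refine summable_norm_of_tsum_eLpNorm_ne_top le_rfl (fun i => (hf i).1) ?_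
  simp_rw [eLpNorm_one_eq_lintegral_enorm,
    ← fun i => ofReal_integral_norm_eq_lintegral_enorm (hf i)]
  exact hsum.tsum_ofReal_ne_top

variable {ℱ : Filtration ℕ m0} {u : ℕ → Ω → ℝ}

lemma integral_eq_add_sum_integral_condExp [IsFiniteMeasure μ] (hint : ∀ t, Integrable (u t) μ)
    (n : ℕ) :
    ∫ ω, u n ω ∂μ = ∫ ω, u 0 ω ∂μ +
      ∑ t ∈ Finset.range n, ∫ ω, (μ[u (t + 1) - u t | ℱ t]) ω ∂μ := by
  have h (t : ℕ) : ∫ ω, (μ[u (t + 1) - u t | ℱ t]) ω ∂μ =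
      ∫ ω, u (t + 1) ω ∂μ - ∫ ω, u t ω ∂μ := by
    rw [integral_condExp (ℱ.le t)]
    exact integral_sub (hint (t + 1)) (hint t)
  simp_rw [h]
  rw [Finset.sum_range_sub fun t => ∫ ω, u t ω ∂μ]
  ring

/-- The conditional increments of a nonnegative integrable process are summable in `L¹` as soon as
their positive parts are. -/
lemma summable_integral_abs_condExp_increment [IsFiniteMeasure μ]
    (hint : ∀ t, Integrable (u t) μ) (hnonneg : ∀ t ω, 0 ≤ u t ω)
    (hsum : Summable (fun t => ∫ ω, max ((μ[u (t + 1) - u t | ℱ t]) ω) 0 ∂μ)) :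
    Summable fun t => ∫ ω, |(μ[u (t + 1) - u t | ℱ t]) ω| ∂μ := by
  have habs (t : ℕ) : ∫ ω, |(μ[u (t + 1) - u t | ℱ t]) ω| ∂μ =
      2 * ∫ ω, max ((μ[u (t + 1) - u t | ℱ t]) ω) 0 ∂μ -
        ∫ ω, (μ[u (t + 1) - u t | ℱ t]) ω ∂μ := by
    have hd : Integrable (μ[u (t + 1) - u t | ℱ t]) μ := integrable_condExp
    rw [← integral_const_mul, ← integral_sub (hd.pos_part.const_mul 2) hd]
    congr 1 with ω
    rcases le_total 0 ((μ[u (t + 1) - u t | ℱ t]) ω) with h | h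
    · rw [abs_of_nonneg h, max_eq_left h]; ring
    · rw [abs_of_nonpos h, max_eq_right h]; ring
  refine summable_of_sum_range_le
    (c := 2 * ∑' t, ∫ ω, max ((μ[u (t + 1) - u t | ℱ t]) ω) 0 ∂μ + ∫ ω, u 0 ω ∂μ)
    (fun t => integral_nonneg fun ω => abs_nonneg _) fun n => ?_
  have hpos := hsum.sum_le_tsum (Finset.range n)
    fun t _ => integral_nonneg fun ω => le_max_right _ _
  have htel := integral_eq_add_sum_integral_condExp (ℱ := ℱ) hint n
  have hn : 0 ≤ ∫ ω, u n ω ∂μ := integral_nonneg (hnonneg n)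
  simp_rw [habs]
  rw [Finset.sum_sub_distrib, ← Finset.mul_sum]
  linarith

/-- The martingale part of a nonnegative integrable process is bounded in `L¹` if the conditional
increments of the process are summable in `L¹`. -/
lemma eLpNorm_martingalePart_le [IsFiniteMeasure μ]
    (hint : ∀ t, Integrable (u t) μ) (hnonneg : ∀ t ω, 0 ≤ u t ω)
    (hsum : Summable fun t => ∫ ω, |(μ[u (t + 1) - u t | ℱ t]) ω| ∂μ) (n : ℕ) :
    eLpNorm (martingalePart u ℱ μ n) 1 μ ≤
      ((∫ ω, u 0 ω ∂μ + 2 * ∑' t, ∫ ω, |(μ[u (t + 1) - u t | ℱ t]) ω| ∂μ).toNNReal : ENNReal) := by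
  have hd (t : ℕ) : Integrable (fun ω => |(μ[u (t + 1) - u t | ℱ t]) ω|) μ :=
    integrable_condExp.abs
  have hM : Integrable (martingalePart u ℱ μ n) μ := integrable_martingalePart hint n
  rw [eLpNorm_one_eq_lintegral_enorm, ← ofReal_integral_norm_eq_lintegral_enorm hM]
  refine ENNReal.ofReal_le_ofReal ?_
  have hle : ∫ ω, ‖martingalePart u ℱ μ n ω‖ ∂μ ≤
      ∫ ω, (u n ω + ∑ t ∈ Finset.range n, |(μ[u (t + 1) - u t | ℱ t]) ω|) ∂μ := by
    refine integral_mono hM.norm ((hint n).add (integrable_finsetSum _ fun t _ => hd t))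
      fun ω => ?_
    simp only [martingalePart, predictablePart, Pi.sub_apply, Finset.sum_apply]
    refine (norm_sub_le _ _).trans (add_le_add ?_ (norm_sum_le _ _))
    rw [Real.norm_of_nonneg (hnonneg n ω)]
  rw [integral_add (hint n) (integrable_finsetSum _ fun t _ => hd t),
    integral_finsetSum _ fun t _ => hd t] at hle
  have htel := integral_eq_add_sum_integral_condExp (ℱ := ℱ) hint n
  have hdle : ∑ t ∈ Finset.range n, ∫ ω, (μ[u (t + 1) - u t | ℱ t]) ω ∂μ ≤
      ∑ t ∈ Finset.range n, ∫ ω, |(μ[u (t + 1) - u t | ℱ t]) ω| ∂μ :=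
    Finset.sum_le_sum fun t _ => integral_mono integrable_condExp (hd t) fun ω => le_abs_self _
  have hT := hsum.sum_le_tsum (Finset.range n)
    fun t _ => integral_nonneg fun ω => abs_nonneg _
  linarith

end MeasureTheory

/-- Quasi-martingale convergence criterion: if `(u t)` is a nonnegative adapted
integrable process and the sum over `t` of the expectations of the positive parts
of `E[u (t+1) - u t | ℱ t]` is finite, then `u t` converges almost surely, and
moreover `∑ t, |E[u (t+1) - u t | ℱ t]| < ∞` almost surely. -/
theorem quasi_martingale_convergence {Ω : Type*} {m0 : MeasurableSpace Ω}
    (μ : Measure Ω) [IsProbabilityMeasure μ] (ℱ : Filtration ℕ m0)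
    (u : ℕ → Ω → ℝ) (hadapt : Adapted ℱ u) (hint : ∀ t, Integrable (u t) μ)
    (hnonneg : ∀ t ω, 0 ≤ u t ω)
    (hsum : Summable (fun t => ∫ ω, max ((μ[u (t + 1) - u t | ℱ t]) ω) 0 ∂μ)) :
    ∀ᵐ ω ∂μ, (∃ l : ℝ, Tendsto (fun t => u t ω) atTop (nhds l)) ∧
      Summable (fun t => |(μ[u (t + 1) - u t | ℱ t]) ω|) := by
  have hL1 := summable_integral_abs_condExp_increment hint hnonneg hsum
  have hM : Martingale (martingalePart u ℱ μ) ℱ μ :=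
    martingale_martingalePart hadapt.stronglyAdapted hint
  filter_upwards [hM.submartingale.exists_ae_tendsto_of_bdd
      (eLpNorm_martingalePart_le hint hnonneg hL1),
    ae_summable_norm_of_summable_integral_norm
      (f := fun t => μ[u (t + 1) - u t | ℱ t]) (fun t => integrable_condExp) hL1]
    with ω ⟨c, hc⟩ hs
  refine ⟨⟨_, (hc.add hs.of_norm.hasSum.tendsto_sum_nat).congr fun n => ?_⟩, hs⟩
  simp [martingalePart, predictablePart]
end

section
/- Let E be a real normed vector space, let g, g' : E → ℝ, let x, y ∈ E, and let μ > 0 and κ ≥ 0. Suppose (i) g(y) − g(x) ≥ μ ‖y − x‖², (ii) g'(y) ≤ g'(x), and (iii) the difference G = g − g' satisfies |G(u) − G(v)| ≤ κ ‖u − v‖ for all u, v ∈ E. Then ‖y − x‖ ≤ κ/μ. -/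
/-- Abstract displacement bound: if `g y − g x ≥ μ ‖y − x‖²`, `g' y ≤ g' x`, and
`g − g'` is `κ`-Lipschitz, then `‖y − x‖ ≤ κ/μ`. -/
theorem displacement_bound {E : Type*} [NormedAddCommGroup E] [NormedSpace ℝ E]
    (g g' : E → ℝ) (x y : E) (μ κ : ℝ) (hμ : 0 < μ) (hκ : 0 ≤ κ)
    (h1 : μ * ‖y - x‖ ^ 2 ≤ g y - g x)
    (h2 : g' y ≤ g' x)
    (h3 : ∀ u v : E, |(g u - g' u) - (g v - g' v)| ≤ κ * ‖u - v‖) :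
    ‖y - x‖ ≤ κ / μ := by
  have hG := (le_abs_self _).trans (h3 y x)
  rw [le_div_iff₀ hμ]
  rcases (norm_nonneg (y - x)).eq_or_lt with h0 | h0
  · simpa [← h0] using hκ
  · exact le_of_mul_le_mul_right (by linarith) h0
end

section
/- Let u ∈ ℝ^p, let λ₂ > 0, and let 𝒢 be a finite family of nonempty subsets (groups) of {1, …, p}. Suppose the family ξ* = (ξ*^g)_{g ∈ 𝒢}, with each ξ*^g ∈ ℝ^p, minimizes (1/2)‖u − ∑_{g ∈ 𝒢} ξ^g‖₂² over all families (ξ^g)_{g ∈ 𝒢} satisfying ‖ξ^g‖₁ ≤ λ₂ and ξ^g_j = 0 for every j ∉ g, for each g ∈ 𝒢. Then s* = u − ∑_{g ∈ 𝒢} ξ*^g is a minimizer over s ∈ ℝ^p of the proximal objective s ↦ (1/2)‖u − s‖₂² + λ₂ Ω(s). -/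
open Finset

/-- The structured sparsity-inducing norm `Ω(s) = ∑_{g ∈ 𝒢} max_{i ∈ g} |s i|`. -/
noncomputable def structNorm {p : ℕ} (G : Finset (Finset (Fin p))) (s : Fin p → ℝ) : ℝ :=
  ∑ g ∈ G, ⨆ i ∈ g, |s i|

/-- The supremum defining `structNorm` is an upper bound for the absolute values on the group. -/
lemma abs_le_iSup_mem {p : ℕ} (g : Finset (Fin p)) (s : Fin p → ℝ) {i : Fin p} (hi : i ∈ g) :
    |s i| ≤ ⨆ i ∈ g, |s i| := by
  have h : (⨆ _ : i ∈ g, |s i|) = |s i| := ciSup_pos hi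
  rw [← h]
  exact le_ciSup (f := fun i ↦ ⨆ _ : i ∈ g, |s i|) (Set.finite_range _).bddAbove i

/-- The supremum defining `structNorm` is attained on a nonempty group. -/
lemma exists_iSup_mem_le_abs {p : ℕ} {g : Finset (Fin p)} (hg : g.Nonempty) (s : Fin p → ℝ) :
    ∃ i ∈ g, ⨆ i ∈ g, |s i| ≤ |s i| := by
  obtain ⟨i, hi, hmax⟩ := g.exists_max_image (fun i ↦ |s i|) hg
  refine ⟨i, hi, Real.iSup_le (fun j ↦ Real.iSup_le (fun hj ↦ hmax j hj) (abs_nonneg _))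
    (abs_nonneg _)⟩

/-- Hölder's inequality for a vector supported on a group, in an `ℓ₁` ball. -/
lemma sum_mul_le_mul_iSup_mem {p : ℕ} {g : Finset (Fin p)} (hg : g.Nonempty) {r : ℝ}
    {v : Fin p → ℝ} (hv : ∑ j, |v j| ≤ r) (hsupp : ∀ j, j ∉ g → v j = 0) (s : Fin p → ℝ) :
    ∑ j, s j * v j ≤ r * ⨆ i ∈ g, |s i| := by
  obtain ⟨i, hi⟩ := hg
  have hnn : 0 ≤ ⨆ i ∈ g, |s i| := (abs_nonneg _).trans (abs_le_iSup_mem g s hi)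
  calc ∑ j, s j * v j ≤ ∑ j, |v j| * ⨆ i ∈ g, |s i| := by
        refine sum_le_sum fun j _ ↦ ?_
        by_cases hj : j ∈ g
        · calc s j * v j ≤ |s j * v j| := le_abs_self _
            _ = |v j| * |s j| := by rw [abs_mul, mul_comm]
            _ ≤ _ := mul_le_mul_of_nonneg_left (abs_le_iSup_mem g s hj) (abs_nonneg _)
        · simp [hsupp j hj]
    _ = (∑ j, |v j|) * ⨆ i ∈ g, |s i| := by rw [sum_mul]
    _ ≤ _ := mul_le_mul_of_nonneg_right hv hnn

/-- First-order optimality: if moving from `a` in direction `-d` never decreases the sum of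
squares, then `d` makes a nonpositive inner product with `a`. -/
lemma sum_mul_nonpos_of_sum_sq_le {ι : Type*} [Fintype ι] (a d : ι → ℝ)
    (h : ∀ t : ℝ, 0 ≤ t → t ≤ 1 → ∑ i, a i ^ 2 ≤ ∑ i, (a i - t * d i) ^ 2) :
    ∑ i, a i * d i ≤ 0 := by
  by_contra! hB
  have hD : 0 ≤ ∑ i, d i ^ 2 := sum_nonneg fun i _ ↦ sq_nonneg _
  have hexp (t : ℝ) : ∑ i, (a i - t * d i) ^ 2 =
      ∑ i, a i ^ 2 - 2 * t * ∑ i, a i * d i + t ^ 2 * ∑ i, d i ^ 2 := by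
    rw [mul_sum, mul_sum, ← sum_sub_distrib, ← sum_add_distrib]
    exact sum_congr rfl fun i _ ↦ by ring
  set B := ∑ i, a i * d i
  set D := ∑ i, d i ^ 2
  have hBD : 0 < B + D := by linarith
  have ht : 0 < B / (B + D) := div_pos hB hBD
  have key := h (B / (B + D)) ht.le ((div_le_one hBD).2 (by linarith))
  rw [hexp] at key
  have hmul : B / (B + D) * (B + D) = B := div_mul_cancel₀ _ hBD.ne'
  set t := B / (B + D)
  have : t * (2 * B) ≤ t * (t * D) := by nlinarith
  have := le_of_mul_le_mul_left this ht
  nlinarith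

/-- At a minimizer of the dual problem, each component `xi g` maximizes the inner product with
the residual over its feasible set. -/
lemma sum_residual_mul_le {p : ℕ} {u : Fin p → ℝ} {r : ℝ} {G : Finset (Finset (Fin p))}
    {xi : Finset (Fin p) → Fin p → ℝ}
    (hfeas : ∀ g ∈ G, (∑ j, |xi g j| ≤ r) ∧ ∀ j, j ∉ g → xi g j = 0)
    (hmin : ∀ xi' : Finset (Fin p) → Fin p → ℝ,
      (∀ g ∈ G, (∑ j, |xi' g j| ≤ r) ∧ ∀ j, j ∉ g → xi' g j = 0) →
      ∑ i, (u i - ∑ g ∈ G, xi g i) ^ 2 ≤ ∑ i, (u i - ∑ g ∈ G, xi' g i) ^ 2)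
    {g : Finset (Fin p)} (hg : g ∈ G) {v : Fin p → ℝ} (hv : ∑ j, |v j| ≤ r)
    (hsupp : ∀ j, j ∉ g → v j = 0) :
    ∑ i, (u i - ∑ g ∈ G, xi g i) * v i ≤ ∑ i, (u i - ∑ g ∈ G, xi g i) * xi g i := by
  have h := sum_mul_nonpos_of_sum_sq_le (fun i ↦ u i - ∑ g ∈ G, xi g i)
    (fun i ↦ v i - xi g i) fun t ht0 ht1 ↦ by
      let w : Fin p → ℝ := fun j ↦ xi g j + t * (v j - xi g j)
      refine (hmin (Function.update xi g w) fun g' hg' ↦ ?_).trans_eq ?_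
      · rcases eq_or_ne g' g with rfl | hne
        · rw [Function.update_self]
          refine ⟨?_, fun j hj ↦ by simp [w, hsupp j hj, (hfeas g' hg').2 j hj]⟩
          calc ∑ j, |w j| ≤ ∑ j, ((1 - t) * |xi g' j| + t * |v j|) := by
                refine sum_le_sum fun j _ ↦ ?_
                have hw : w j = (1 - t) * xi g' j + t * v j := by simp only [w]; ring
                rw [hw]
                refine (abs_add_le _ _).trans_eq ?_
                rw [abs_mul, abs_mul, abs_of_nonneg ht0, abs_of_nonneg (sub_nonneg.2 ht1)]
            _ = (1 - t) * ∑ j, |xi g' j| + t * ∑ j, |v j| := by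
                rw [sum_add_distrib, mul_sum, mul_sum]
            _ ≤ (1 - t) * r + t * r := add_le_add
                (mul_le_mul_of_nonneg_left (hfeas g' hg').1 (sub_nonneg.2 ht1))
                (mul_le_mul_of_nonneg_left hv ht0)
            _ = r := by ring
        · rw [Function.update_of_ne hne]
          exact hfeas g' hg'
      · refine sum_congr rfl fun i _ ↦ ?_
        have hsum : ∑ g' ∈ G, Function.update xi g w g' i =
            ∑ g' ∈ G, xi g' i + t * (v i - xi g i) := by
          rw [← add_sum_erase G _ hg, ← add_sum_erase G (fun g' ↦ xi g' i) hg,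
            Function.update_self, sum_congr rfl fun g' hg' ↦ by
              rw [Function.update_of_ne (ne_of_mem_erase hg')]]
          simp only [w]
          ring
        rw [hsum]
        ring
  simpa [mul_sub, sum_sub_distrib] using h

/-- Duality between the proximal operator of the `ℓ₁/ℓ∞` structured sparsity norm and
the quadratic min-cost flow problem: if `ξ*` minimizes `(1/2)‖u − ∑_g ξ^g‖₂²` over all
families with `‖ξ^g‖₁ ≤ λ₂` and `ξ^g` supported on `g`, then `s* = u − ∑_g ξ*^g`
minimizes `s ↦ (1/2)‖u − s‖₂² + λ₂ Ω(s)`. -/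
theorem proxflow_duality {p : ℕ} (u : Fin p → ℝ) (l2 : ℝ) (hl2 : 0 < l2)
    (G : Finset (Finset (Fin p))) (hG : ∀ g ∈ G, g.Nonempty)
    (xi : Finset (Fin p) → Fin p → ℝ)
    (hfeas : ∀ g ∈ G, (∑ j, |xi g j| ≤ l2) ∧ ∀ j, j ∉ g → xi g j = 0)
    (hmin : ∀ xi' : Finset (Fin p) → Fin p → ℝ,
      (∀ g ∈ G, (∑ j, |xi' g j| ≤ l2) ∧ ∀ j, j ∉ g → xi' g j = 0) →
      (1 / 2) * ∑ i, (u i - ∑ g ∈ G, xi g i) ^ 2 ≤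
        (1 / 2) * ∑ i, (u i - ∑ g ∈ G, xi' g i) ^ 2)
    (sstar : Fin p → ℝ) (hsstar : ∀ i, sstar i = u i - ∑ g ∈ G, xi g i) :
    ∀ s : Fin p → ℝ,
      (1 / 2) * ∑ i, (u i - sstar i) ^ 2 + l2 * structNorm G sstar ≤
        (1 / 2) * ∑ i, (u i - s i) ^ 2 + l2 * structNorm G s := by
  intro s
  have hres (i : Fin p) : ∑ g ∈ G, xi g i = u i - sstar i := by linarith [hsstar i]
  have hswap (x : Fin p → ℝ) :
      ∑ g ∈ G, ∑ j, x j * xi g j = ∑ j, x j * (u j - sstar j) := by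
    rw [sum_comm]
    exact sum_congr rfl fun j _ ↦ by rw [← mul_sum, hres]
  have hupper : ∑ j, s j * (u j - sstar j) ≤ l2 * structNorm G s := by
    rw [← hswap, structNorm, mul_sum]
    exact sum_le_sum fun g hg ↦
      sum_mul_le_mul_iSup_mem (hG g hg) (hfeas g hg).1 (hfeas g hg).2 s
  have hlower : l2 * structNorm G sstar ≤ ∑ j, sstar j * (u j - sstar j) := by
    rw [← hswap, structNorm, mul_sum]
    refine sum_le_sum fun g hg ↦ ?_
    obtain ⟨i, hi, hmax⟩ := exists_iSup_mem_le_abs (hG g hg) sstar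
    have hsign : |(SignType.sign (sstar i) : ℝ)| ≤ 1 := by
      rcases lt_trichotomy (sstar i) 0 with h | h | h <;> simp [h]
    have h := sum_residual_mul_le hfeas
      (fun xi' h ↦ le_of_mul_le_mul_left (hmin xi' h) (by norm_num)) hg
      (v := Pi.single i (l2 * SignType.sign (sstar i)))
      (by
        rw [sum_eq_single i (fun j _ hj ↦ by simp [hj]) (by simp), Pi.single_eq_same, abs_mul,
          abs_of_pos hl2]
        exact mul_le_of_le_one_right hl2.le hsign)
      (fun j hj ↦ Pi.single_eq_of_ne (ne_of_mem_of_not_mem hi hj).symm _)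
    simp only [← hsstar] at h
    refine (mul_le_mul_of_nonneg_left hmax hl2.le).trans (le_trans (le_of_eq ?_) h)
    rw [sum_eq_single i (fun j _ hj ↦ by simp [hj]) (by simp), Pi.single_eq_same,
      ← self_mul_sign]
    ring
  have hsq : 0 ≤ ∑ i, (s i - sstar i) ^ 2 := sum_nonneg fun i _ ↦ sq_nonneg _
  have hexp : ∑ i, (s i - sstar i) ^ 2 = ∑ i, (u i - s i) ^ 2 - ∑ i, (u i - sstar i) ^ 2
      + 2 * ∑ i, s i * (u i - sstar i) - 2 * ∑ i, sstar i * (u i - sstar i) := by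
    rw [mul_sum, mul_sum, ← sum_sub_distrib, ← sum_add_distrib, ← sum_sub_distrib]
    exact sum_congr rfl fun i _ ↦ by ring
  linarith
end
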